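/- arXiv:2508.21594 — 2 statements merged into one kernel-verified Lean document; each statement's English description precedes it below -/
import Mathlib

section
/- (The split likelihood ratio is an e-process under the null.) Fix an adaptive measurement scheme with horizon t, disjoint sets S₀ and S₁ of density matrices on ℂ^d, null and alternative MLE maps ρ̂₀^s and ρ̂₁^s for all 0 ≤ s ≤ t, and assume Tr(ρ^{⊗n_i} M^i(h)_x) > 0 for every ρ ∈ S₀ ∪ S₁, round i, history h, and outcome x. Let Λ₀^s be the associated split likelihood ratio (with Λ₀^0 = 1) and let τ : X^t → {0,1,…,t} be any non-anticipating stopping rule, i.e., for any x, x' ∈ X^t agreeing in their first s coordinates, τ(x) = s if and only if τ(x') = s. Then for every ρ ∈ S₀, the stopped split likelihood ratio has expectation at most one: ∑_{x∈X^t} P_ρ(x) · Λ₀^{τ(x)}(x) ≤ 1. -/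
open Matrix BigOperators
open scoped ComplexOrder

noncomputable section

/-- A density matrix on `ℂ^d`: positive semidefinite with trace 1. -/
def IsDensityMatrix {d : ℕ} (ρ : Matrix (Fin d) (Fin d) ℂ) : Prop :=
  ρ.PosSemidef ∧ ρ.trace = 1

/-- A POVM with finite outcome set `X`: positive semidefinite effects summing to the identity. -/
def IsPOVM {m : Type*} [Fintype m] [DecidableEq m] {X : Type*} [Fintype X]
    (M : X → Matrix m m ℂ) : Prop :=
  (∀ x, (M x).PosSemidef) ∧ ∑ x, M x = 1

/-- The `n`-fold tensor power of a `d × d` matrix, indexed by tuples in `Fin n → Fin d`,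
with entries `(ρ^{⊗n})_{x,y} = ∏ i, ρ (x i) (y i)`. -/
def tensorPow {d : ℕ} (ρ : Matrix (Fin d) (Fin d) ℂ) (n : ℕ) :
    Matrix (Fin n → Fin d) (Fin n → Fin d) ℂ :=
  fun x y => ∏ i, ρ (x i) (y i)

/-- Born probability `Tr(ρ M)` as the associated (nonnegative) real number. -/
def bornProb {m : Type*} [Fintype m] (ρ M : Matrix m m ℂ) : ℝ :=
  ((ρ * M).trace).re

/-- An adaptive measurement scheme with horizon `t`: at round `i` (0-based), given a
history `h ∈ X^i`, it measures `n i ≥ 1` fresh copies with the POVM `M i h`. -/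
structure AdaptiveScheme (d : ℕ) (X : Type*) [Fintype X] (t : ℕ) where
  n : Fin t → ℕ
  hn : ∀ i, 1 ≤ n i
  M : (i : Fin t) → (Fin i → X) → X →
        Matrix (Fin (n i) → Fin d) (Fin (n i) → Fin d) ℂ
  hM : ∀ i h, IsPOVM (M i h)

/-- The history (first `i` outcomes) of an outcome sequence `x`. -/
def hist {X : Type*} {t : ℕ} (x : Fin t → X) (i : Fin t) : Fin i → X :=
  fun j => x ⟨j, j.isLt.trans i.isLt⟩

/-- Probability of observing the outcome sequence `x` under state `ρ`. -/
def seqProb {d t : ℕ} {X : Type*} [Fintype X] (S : AdaptiveScheme d X t)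
    (ρ : Matrix (Fin d) (Fin d) ℂ) (x : Fin t → X) : ℝ :=
  ∏ i, bornProb (tensorPow ρ (S.n i)) (S.M i (hist x i) (x i))

/-- Likelihood of the first `s` outcomes of a history `h ∈ X^s` under state `ρ`:
`∏_{i=1}^{s} Tr(ρ^{⊗ n_i} M^i(h_1,…,h_{i-1})_{h_i})` (rounds beyond the horizon contribute 1). -/
def likOnHist {d t : ℕ} {X : Type*} [Fintype X] (S : AdaptiveScheme d X t)
    (ρ : Matrix (Fin d) (Fin d) ℂ) (s : ℕ) (h : Fin s → X) : ℝ :=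
  ∏ i : Fin t, if hi : (i : ℕ) < s then
    bornProb (tensorPow ρ (S.n i))
      (S.M i (fun j => h ⟨j, j.isLt.trans hi⟩) (h ⟨i, hi⟩))
  else 1

/-- An MLE map for the class `S₀`: at each time `s ≤ t` and history `h ∈ X^s`, it returns a
state of `S₀` maximizing the likelihood of `h` over `S₀`. -/
def IsMLEMap {d t : ℕ} {X : Type*} [Fintype X] (S : AdaptiveScheme d X t)
    (S₀ : Set (Matrix (Fin d) (Fin d) ℂ))
    (est : (s : ℕ) → (Fin s → X) → Matrix (Fin d) (Fin d) ℂ) : Prop :=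
  ∀ s : ℕ, s ≤ t → ∀ h : Fin s → X,
    est s h ∈ S₀ ∧ ∀ ρ' ∈ S₀, likOnHist S ρ' s h ≤ likOnHist S (est s h) s h

/-- The split likelihood ratio at time `s ≤ t`:
`Λ₀^s(x) = ∏_{i=1}^{s} Tr((ρ̂₁^{i-1}(x_{<i}))^{⊗n_i} M^i_{x_i}) / Tr((ρ̂₀^{s}(x_{≤s}))^{⊗n_i} M^i_{x_i})`,
with non-anticipating alternative MLEs in the numerator and the time-`s` null MLE in the
denominator. -/
def slr₀ {d t : ℕ} {X : Type*} [Fintype X] (S : AdaptiveScheme d X t)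
    (est₀ est₁ : (s : ℕ) → (Fin s → X) → Matrix (Fin d) (Fin d) ℂ)
    (x : Fin t → X) (s : ℕ) (hs : s ≤ t) : ℝ :=
  ∏ i : Fin t, if (i : ℕ) < s then
    bornProb (tensorPow (est₁ i (hist x i)) (S.n i)) (S.M i (hist x i) (x i)) /
      bornProb (tensorPow (est₀ s (fun j => x (Fin.castLE hs j))) (S.n i))
        (S.M i (hist x i) (x i))
  else 1

/-- The reversed split likelihood ratio at time `s ≤ t`, exchanging the roles of the null and
alternative hypotheses:
`Λ₁^s(x) = ∏_{i=1}^{s} Tr((ρ̂₀^{i-1}(x_{<i}))^{⊗n_i} M^i_{x_i}) / Tr((ρ̂₁^{s}(x_{≤s}))^{⊗n_i} M^i_{x_i})`. -/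
def slr₁ {d t : ℕ} {X : Type*} [Fintype X] (S : AdaptiveScheme d X t)
    (est₀ est₁ : (s : ℕ) → (Fin s → X) → Matrix (Fin d) (Fin d) ℂ)
    (x : Fin t → X) (s : ℕ) (hs : s ≤ t) : ℝ :=
  ∏ i : Fin t, if (i : ℕ) < s then
    bornProb (tensorPow (est₀ i (hist x i)) (S.n i)) (S.M i (hist x i) (x i)) /
      bornProb (tensorPow (est₁ s (fun j => x (Fin.castLE hs j))) (S.n i))
        (S.M i (hist x i) (x i))
  else 1

theorem trace_tensorPow {d : ℕ} (ρ : Matrix (Fin d) (Fin d) ℂ) (n : ℕ) :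
    (tensorPow ρ n).trace = ρ.trace ^ n := by
  simp only [Matrix.trace, Matrix.diag, tensorPow]
  exact (Fintype.sum_pow (fun a => ρ a a) n).symm

theorem IsPOVM.sum_bornProb {m : Type*} [Fintype m] [DecidableEq m] {X : Type*} [Fintype X]
    {M : X → Matrix m m ℂ} (hM : IsPOVM M) (ρ : Matrix m m ℂ) :
    ∑ x, bornProb ρ (M x) = ρ.trace.re := by
  simp only [bornProb]
  rw [← Complex.re_sum, ← Matrix.trace_sum, ← Finset.mul_sum, hM.2, mul_one]

theorem AdaptiveScheme.sum_bornProb_tensorPow {d t : ℕ} {X : Type*} [Fintype X]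
    (S : AdaptiveScheme d X t) {ρ : Matrix (Fin d) (Fin d) ℂ} (hρ : IsDensityMatrix ρ)
    (i : Fin t) (h : Fin i → X) :
    ∑ x, bornProb (tensorPow ρ (S.n i)) (S.M i h x) = 1 := by
  rw [(S.hM i h).sum_bornProb, trace_tensorPow, hρ.2, one_pow, Complex.one_re]

/-- Chaining conditional weights that sum to one yields weights on sequences that sum to one. -/
theorem sum_prod_hist_eq_one {X : Type*} [Fintype X] {t : ℕ}
    (w : (i : Fin t) → (Fin i → X) → X → ℝ) (hw : ∀ i h, ∑ x, w i h x = 1) :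
    ∑ x : Fin t → X, ∏ i, w i (hist x i) (x i) = 1 := by
  induction t with
  | zero => simp
  | succ t ih =>
    have key : ∀ (y : Fin t → X) (a : X),
        ∏ i, w i (hist (Fin.snoc y a : Fin (t + 1) → X) i)
            ((Fin.snoc y a : Fin (t + 1) → X) i) =
          (∏ i : Fin t, w i.castSucc (hist y i) (y i)) * w (Fin.last t) y a := by
      intro y a
      rw [Fin.prod_univ_castSucc]
      congr 1
      · refine Finset.prod_congr rfl fun i _ => ?_
        rw [Fin.snoc_castSucc]
        congr 1
        funext j
        exact Fin.snoc_castSucc (α := fun _ => X) a y ⟨j, j.isLt.trans i.isLt⟩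
      · rw [Fin.snoc_last]
        congr 1
        funext j
        exact Fin.snoc_castSucc (α := fun _ => X) a y j
    rw [← (Fin.snocEquiv fun _ => X).sum_comp, Fintype.sum_prod_type_right]
    refine Eq.trans (Finset.sum_congr rfl fun y _ => ?_)
      (ih (fun i => w i.castSucc) fun i h => hw i.castSucc h)
    refine (Finset.sum_congr rfl fun a _ => key y a).trans ?_
    rw [← Finset.mul_sum, hw (Fin.last t) y, mul_one]

theorem likOnHist_castLE {d t : ℕ} {X : Type*} [Fintype X] (S : AdaptiveScheme d X t)
    (ρ : Matrix (Fin d) (Fin d) ℂ) (x : Fin t → X) (s : ℕ) (hs : s ≤ t) :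
    likOnHist S ρ s (fun j => x (Fin.castLE hs j)) =
      ∏ i : Fin t, if (i : ℕ) < s then
        bornProb (tensorPow ρ (S.n i)) (S.M i (hist x i) (x i)) else 1 := by
  refine Finset.prod_congr rfl fun i _ => ?_
  split_ifs <;> rfl

/-- Before a deterministic time, the split likelihood ratio replaces the null likelihood by at most
the predictive alternative likelihood. -/
theorem seqProb_mul_slr₀_le {d t : ℕ} {X : Type*} [Fintype X] (S : AdaptiveScheme d X t)
    {S₀ S₁ : Set (Matrix (Fin d) (Fin d) ℂ)}
    {est₀ est₁ : (s : ℕ) → (Fin s → X) → Matrix (Fin d) (Fin d) ℂ}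
    (h₀ : IsMLEMap S S₀ est₀) (h₁ : IsMLEMap S S₁ est₁)
    (hpos : ∀ ρ' ∈ S₀ ∪ S₁, ∀ (i : Fin t) (h : Fin i → X) (x : X),
      0 < bornProb (tensorPow ρ' (S.n i)) (S.M i h x))
    {ρ : Matrix (Fin d) (Fin d) ℂ} (hρ : ρ ∈ S₀) (x : Fin t → X) (s : ℕ) (hs : s ≤ t) :
    seqProb S ρ x * slr₀ S est₀ est₁ x s hs ≤
      ∏ i : Fin t, bornProb (tensorPow (if (i : ℕ) < s then est₁ i (hist x i) else ρ) (S.n i))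
        (S.M i (hist x i) (x i)) := by
  obtain ⟨hmem, hmax⟩ := h₀ s hs (fun j => x (Fin.castLE hs j))
  have hle := hmax ρ hρ
  rw [likOnHist_castLE, likOnHist_castLE] at hle
  set σ := est₀ s (fun j => x (Fin.castLE hs j)) with hσ
  have hden : 0 < ∏ i : Fin t, if (i : ℕ) < s then
      bornProb (tensorPow σ (S.n i)) (S.M i (hist x i) (x i)) else 1 := by
    refine Finset.prod_pos fun i _ => ?_
    split_ifs
    · exact hpos σ (Or.inl hmem) _ _ _
    · exact one_pos
  have hnonneg : 0 ≤ ∏ i : Fin t,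
      bornProb (tensorPow (if (i : ℕ) < s then est₁ i (hist x i) else ρ) (S.n i))
        (S.M i (hist x i) (x i)) := by
    refine Finset.prod_nonneg fun i _ => (hpos _ ?_ _ _ _).le
    split_ifs
    · exact Or.inr (h₁ i i.isLt.le _).1
    · exact Or.inl hρ
  refine le_trans (le_of_eq ?_) (mul_le_of_le_one_right hnonneg ((div_le_one hden).2 hle))
  rw [seqProb, slr₀, ← Finset.prod_div_distrib, ← Finset.prod_mul_distrib,
    ← Finset.prod_mul_distrib]
  refine Finset.prod_congr rfl fun i _ => ?_
  rw [← hσ]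
  split_ifs
  · ring
  · ring

/-- Whether a stopping rule has not stopped by round `i` depends only on the first `i` outcomes. -/
theorem lt_stopping_iff_of_hist_eq {t : ℕ} {X : Type*} {τ : (Fin t → X) → ℕ}
    (hτ : ∀ (x x' : Fin t → X) (s : ℕ),
      (∀ i : Fin t, (i : ℕ) < s → x i = x' i) → (τ x = s ↔ τ x' = s))
    {x x' : Fin t → X} {i : Fin t} (h : hist x i = hist x' i) :
    (i : ℕ) < τ x ↔ (i : ℕ) < τ x' := by
  have agree : ∀ j : Fin t, (j : ℕ) < i → x j = x' j := fun j hj => congrFun h ⟨j, hj⟩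
  constructor
  · intro hi
    by_contra! hle
    have := (hτ x x' (τ x') fun j hj => agree j (hj.trans_le hle)).2 rfl
    omega
  · intro hi
    by_contra! hle
    have := (hτ x x' (τ x) fun j hj => agree j (hj.trans_le hle)).1 rfl
    omega

/-- the split likelihood ratio is an e-process under the null — for any
non-anticipating stopping rule, the stopped split likelihood ratio has expectation at most one
under every null state. -/
theorem slr_is_eprocess_under_null {d t : ℕ} {X : Type*} [Fintype X]
    (ht : 1 ≤ t) (S : AdaptiveScheme d X t)
    (S₀ S₁ : Set (Matrix (Fin d) (Fin d) ℂ)) (hdisj : Disjoint S₀ S₁)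
    (hS₀ : ∀ ρ' ∈ S₀, IsDensityMatrix ρ') (hS₁ : ∀ ρ' ∈ S₁, IsDensityMatrix ρ')
    (est₀ est₁ : (s : ℕ) → (Fin s → X) → Matrix (Fin d) (Fin d) ℂ)
    (h₀ : IsMLEMap S S₀ est₀) (h₁ : IsMLEMap S S₁ est₁)
    (hpos : ∀ ρ' ∈ S₀ ∪ S₁, ∀ (i : Fin t) (h : Fin i → X) (x : X),
      0 < bornProb (tensorPow ρ' (S.n i)) (S.M i h x))
    (τ : (Fin t → X) → ℕ) (hτle : ∀ x, τ x ≤ t)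
    (hτ : ∀ (x x' : Fin t → X) (s : ℕ),
      (∀ i : Fin t, (i : ℕ) < s → x i = x' i) → (τ x = s ↔ τ x' = s))
    (ρ : Matrix (Fin d) (Fin d) ℂ) (hρ : ρ ∈ S₀) :
    ∑ x : Fin t → X, seqProb S ρ x * slr₀ S est₀ est₁ x (τ x) (hτle x) ≤ 1 := by
  classical
  let σ : (i : Fin t) → (Fin i → X) → Matrix (Fin d) (Fin d) ℂ := fun i h =>
    if ∃ y : Fin t → X, hist y i = h ∧ (i : ℕ) < τ y then est₁ i h else ρ
  have hσ : ∀ i h, IsDensityMatrix (σ i h) := by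
    intro i h
    dsimp only [σ]
    split_ifs
    · exact hS₁ _ (h₁ i i.isLt.le h).1
    · exact hS₀ ρ hρ
  refine le_of_le_of_eq (Finset.sum_le_sum fun x _ =>
    (seqProb_mul_slr₀_le S h₀ h₁ hpos hρ x (τ x) (hτle x)).trans_eq ?_)
    (sum_prod_hist_eq_one (fun i h a => bornProb (tensorPow (σ i h) (S.n i)) (S.M i h a))
      fun i h => S.sum_bornProb_tensorPow (hσ i h) i h)
  refine Finset.prod_congr rfl fun i _ => ?_
  have hiff : (i : ℕ) < τ x ↔ ∃ y : Fin t → X, hist y i = hist x i ∧ (i : ℕ) < τ y :=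
    ⟨fun hi => ⟨x, rfl, hi⟩, fun ⟨_, hy, hi⟩ => (lt_stopping_iff_of_hist_eq hτ hy).1 hi⟩
  simp only [σ, hiff]
end
end

section
/- (Crossing implication for the two parallel split likelihood ratios.) Fix an adaptive measurement scheme with horizon t, an outcome sequence x ∈ X^t, disjoint sets S₀ and S₁ of density matrices on ℂ^d, null and alternative MLE maps ρ̂₀^s and ρ̂₁^s for all 0 ≤ s ≤ t, and assume Tr(ρ^{⊗n_i} M^i(x_1,…,x_{i-1})_{x_i}) > 0 for every ρ ∈ S₀ ∪ S₁ and every i ≤ t. Let Λ₀^t(x) and Λ₁^t(x) be the associated split likelihood ratio and reversed split likelihood ratio at time t. Then for every ε₀ > 0: if Λ₀^t(x) ≥ 1/ε₀ then Λ₁^t(x) ≤ ε₀. -/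
open Matrix BigOperators
open scoped ComplexOrder

noncomputable section

/-- Splitting off the round `s` from a product over the first `s + 1` rounds. -/
theorem prod_ite_lt_succ {α : Type*} [CommMonoid α] {t s : ℕ} (hs : s < t) (a : Fin t → α) :
    (∏ i : Fin t, if (i : ℕ) < s + 1 then a i else 1) =
      (∏ i : Fin t, if (i : ℕ) < s then a i else 1) * a ⟨s, hs⟩ := by
  have key : ∀ i : Fin t, (if (i : ℕ) < s + 1 then a i else 1) =
      (if (i : ℕ) < s then a i else 1) * (if i = ⟨s, hs⟩ then a i else 1) := by
    intro i
    rcases lt_trichotomy (i : ℕ) s with h | h | h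
    · have h' : i ≠ ⟨s, hs⟩ := fun e => h.ne (congrArg Fin.val e)
      simp [h, h', Nat.lt_succ_of_lt h]
    · have h' : i = ⟨s, hs⟩ := Fin.ext h
      simp [h']
    · have h' : i ≠ ⟨s, hs⟩ := fun e => h.ne' (congrArg Fin.val e)
      simp [h', h.not_gt, Nat.not_lt.mpr (Nat.succ_le_of_lt h)]
  rw [Finset.prod_congr rfl fun i _ => key i, Finset.prod_mul_distrib]
  simp

/-- The likelihood of a prefix of `x`, as a product over the rounds of the whole sequence. -/
theorem likOnHist_prefix {d t : ℕ} {X : Type*} [Fintype X] (S : AdaptiveScheme d X t)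
    (ρ : Matrix (Fin d) (Fin d) ℂ) (x : Fin t → X) {s : ℕ} (hs : s ≤ t) :
    likOnHist S ρ s (fun j => x (Fin.castLE hs j)) = ∏ i : Fin t, if (i : ℕ) < s then
      bornProb (tensorPow ρ (S.n i)) (S.M i (hist x i) (x i)) else 1 := by
  refine Finset.prod_congr rfl fun i _ => ?_
  split_ifs <;> rfl

/-- The non-anticipating sequence of maximum likelihood estimates has at most the likelihood
of the final maximum likelihood estimate. -/
theorem IsMLEMap.prod_predictive_le {d t : ℕ} {X : Type*} [Fintype X]
    {S : AdaptiveScheme d X t} {C : Set (Matrix (Fin d) (Fin d) ℂ)}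
    {est : (s : ℕ) → (Fin s → X) → Matrix (Fin d) (Fin d) ℂ} (h : IsMLEMap S C est)
    {x : Fin t → X}
    (hpos : ∀ ρ ∈ C, ∀ i : Fin t,
      0 ≤ bornProb (tensorPow ρ (S.n i)) (S.M i (hist x i) (x i)))
    {s : ℕ} (hs : s ≤ t) :
    (∏ i : Fin t, if (i : ℕ) < s then
      bornProb (tensorPow (est i (hist x i)) (S.n i)) (S.M i (hist x i) (x i)) else 1) ≤
    likOnHist S (est s (fun j => x (Fin.castLE hs j))) s (fun j => x (Fin.castLE hs j)) := by
  induction s with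
  | zero => simp [likOnHist]
  | succ s ih =>
    have hs' : s ≤ t := Nat.le_of_succ_le hs
    have hmem := (h s hs' (fun j => x (Fin.castLE hs' j))).1
    refine le_trans ?_ ((h (s + 1) hs (fun j => x (Fin.castLE hs j))).2 _ hmem)
    rw [likOnHist_prefix S _ x hs, prod_ite_lt_succ hs, prod_ite_lt_succ hs,
      ← likOnHist_prefix S _ x hs']
    exact mul_le_mul_of_nonneg_right (ih hs') (hpos _ hmem _)

/-- crossing implication for the two parallel split likelihood ratios — if the
split likelihood ratio at time `t` is at least `1/ε₀`, then the reversed split likelihood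
ratio at time `t` is at most `ε₀`. -/
theorem slr_crossing_implication {d t : ℕ} {X : Type*} [Fintype X]
    (ht : 1 ≤ t) (S : AdaptiveScheme d X t) (x : Fin t → X)
    (S₀ S₁ : Set (Matrix (Fin d) (Fin d) ℂ)) (hdisj : Disjoint S₀ S₁)
    (hS₀ : ∀ ρ' ∈ S₀, IsDensityMatrix ρ') (hS₁ : ∀ ρ' ∈ S₁, IsDensityMatrix ρ')
    (est₀ est₁ : (s : ℕ) → (Fin s → X) → Matrix (Fin d) (Fin d) ℂ)
    (h₀ : IsMLEMap S S₀ est₀) (h₁ : IsMLEMap S S₁ est₁)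
    (hpos : ∀ ρ' ∈ S₀ ∪ S₁, ∀ i : Fin t,
      0 < bornProb (tensorPow ρ' (S.n i)) (S.M i (hist x i) (x i)))
    (ε₀ : ℝ) (hε₀ : 0 < ε₀)
    (hcross : 1 / ε₀ ≤ slr₀ S est₀ est₁ x t le_rfl) :
    slr₁ S est₀ est₁ x t le_rfl ≤ ε₀ := by
  have p₀ : ∀ ρ ∈ S₀, ∀ i : Fin t,
      0 < bornProb (tensorPow ρ (S.n i)) (S.M i (hist x i) (x i)) :=
    fun ρ hρ => hpos ρ (Or.inl hρ)
  have p₁ : ∀ ρ ∈ S₁, ∀ i : Fin t,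
      0 < bornProb (tensorPow ρ (S.n i)) (S.M i (hist x i) (x i)) :=
    fun ρ hρ => hpos ρ (Or.inr hρ)
  have le₀ := h₀.prod_predictive_le (fun ρ hρ i => (p₀ ρ hρ i).le) (le_refl t)
  have le₁ := h₁.prod_predictive_le (fun ρ hρ i => (p₁ ρ hρ i).le) (le_refl t)
  rw [likOnHist_prefix] at le₀ le₁
  simp only [slr₀, slr₁, Fin.is_lt, if_true, Finset.prod_div_distrib] at le₀ le₁ hcross ⊢
  have b₀ := Finset.prod_pos fun i (_ : i ∈ Finset.univ) =>
    p₀ _ (h₀ t le_rfl (fun j => x (Fin.castLE le_rfl j))).1 i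
  have b₁ := Finset.prod_pos fun i (_ : i ∈ Finset.univ) =>
    p₁ _ (h₁ t le_rfl (fun j => x (Fin.castLE le_rfl j))).1 i
  rw [div_le_div_iff₀ hε₀ b₀, one_mul] at hcross
  rw [div_le_iff₀ b₁]
  calc _ ≤ _ := le₀
    _ ≤ _ := hcross
    _ ≤ _ := mul_le_mul_of_nonneg_right le₁ hε₀.le
    _ = _ := mul_comm _ _
end
end
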